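/- Let n ≥ 1 and let H be a finite abelian group (under matrix multiplication) of n-qubit Pauli strings, each with phase φ ∈ {+1, −1}, such that −I ∉ H, and let ρ = (1/2^n) ∑_{h ∈ H} h. Then |H| = 2^ℓ for some natural number ℓ ≤ n, and the base-2 von Neumann entropy of ρ equals S(ρ) = n − log₂|H| = n − ℓ; in particular S(ρ) is a nonnegative integer. -/

import Mathlib

open Matrix BigOperators
open scoped ComplexOrder

/-- The four single-qubit Pauli matrices `σ⁰, σ¹, σ², σ³`. -/
noncomputable def pauliMat : Fin 4 → Matrix (Fin 2) (Fin 2) ℂ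
  | 0 => !![1, 0; 0, 1]
  | 1 => !![0, 1; 1, 0]
  | 2 => !![0, -Complex.I; Complex.I, 0]
  | 3 => !![1, 0; 0, -1]

/-- The Pauli string with global phase `φ` and type `α`, as a matrix on `ι` qubits. -/
noncomputable def pauliString {ι : Type*} [Fintype ι] (φ : ℂ) (α : ι → Fin 4) :
    Matrix (ι → Fin 2) (ι → Fin 2) ℂ :=
  Matrix.of fun x y => φ * ∏ j, pauliMat (α j) (x j) (y j)

/-- Base-2 von Neumann entropy of a (Hermitian) matrix: `S(ρ) = −∑ μᵢ log₂ μᵢ` over the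
eigenvalues with multiplicity (and `0` if `ρ` is not Hermitian). -/
noncomputable def vnEntropy {m : Type*} [Fintype m] [DecidableEq m] (ρ : Matrix m m ℂ) : ℝ := by
  classical exact
    if h : ρ.IsHermitian then -∑ i, h.eigenvalues i * Real.logb 2 (h.eigenvalues i) else 0

theorem pauliMat_isHermitian (a : Fin 4) : (pauliMat a).IsHermitian := by
  ext i j
  fin_cases a <;> fin_cases i <;> fin_cases j <;> simp [pauliMat, Matrix.conjTranspose_apply]

theorem pauliMat_mul_self (a : Fin 4) : pauliMat a * pauliMat a = 1 := by
  fin_cases a <;> ext i j <;> fin_cases i <;> fin_cases j <;>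
    simp [pauliMat, Matrix.mul_apply, Fin.sum_univ_two]

theorem pauliMat_zero : pauliMat 0 = 1 := by
  ext i j
  fin_cases i <;> fin_cases j <;> simp [pauliMat]

theorem trace_pauliMat {a : Fin 4} (ha : a ≠ 0) : (pauliMat a).trace = 0 := by
  fin_cases a <;> simp_all [pauliMat, Matrix.trace, Fin.sum_univ_two]

section PauliString

variable {ι : Type*} [Fintype ι]

theorem pauliString_isHermitian {φ : ℂ} (hφ : star φ = φ) (α : ι → Fin 4) :
    (pauliString φ α).IsHermitian := by
  ext x y
  have h (j : ι) : star (pauliMat (α j) (y j) (x j)) = pauliMat (α j) (x j) (y j) :=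
    (pauliMat_isHermitian (α j)).apply _ _
  rw [Matrix.conjTranspose_apply, pauliString, Matrix.of_apply, Matrix.of_apply, star_mul', hφ,
    ← starRingEnd_apply, map_prod]
  exact congrArg (φ * ·) (Finset.prod_congr rfl fun j _ => h j)

theorem prod_one_apply [DecidableEq ι] (x y : ι → Fin 2) :
    ∏ j, (1 : Matrix (Fin 2) (Fin 2) ℂ) (x j) (y j) =
      (1 : Matrix (ι → Fin 2) (ι → Fin 2) ℂ) x y := by
  simp only [Matrix.one_apply, Finset.prod_ite_zero, funext_iff, Finset.mem_univ, true_imp_iff,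
    Finset.prod_const_one]

theorem pauliString_mul_self [DecidableEq ι] (φ : ℂ) (α : ι → Fin 4) :
    pauliString φ α * pauliString φ α = (φ * φ) • 1 := by
  ext x y
  have h : ∑ z : ι → Fin 2, ∏ j, pauliMat (α j) (x j) (z j) * pauliMat (α j) (z j) (y j) =
      (1 : Matrix (ι → Fin 2) (ι → Fin 2) ℂ) x y := by
    rw [← Fintype.prod_sum fun j k => pauliMat (α j) (x j) k * pauliMat (α j) k (y j),
      ← prod_one_apply]
    simp only [← Matrix.mul_apply, pauliMat_mul_self]
  rw [Matrix.smul_apply, ← h, smul_eq_mul, Finset.mul_sum, Matrix.mul_apply]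
  refine Finset.sum_congr rfl fun z _ => ?_
  simp only [pauliString, Matrix.of_apply, Finset.prod_mul_distrib]
  ring

theorem trace_pauliString [DecidableEq ι] (φ : ℂ) (α : ι → Fin 4) :
    (pauliString φ α).trace = φ * ∏ j, (pauliMat (α j)).trace := by
  simp only [Matrix.trace, Matrix.diag_apply, pauliString, Matrix.of_apply, Fintype.prod_sum,
    Finset.mul_sum]

theorem pauliString_zero [DecidableEq ι] (φ : ℂ) :
    pauliString φ (0 : ι → Fin 4) = φ • 1 := by
  ext x y
  simp [pauliString, pauliMat_zero, prod_one_apply]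

theorem trace_pauliString_eq_zero [DecidableEq ι] {φ : ℂ} {α : ι → Fin 4} (hα : α ≠ 0) :
    (pauliString φ α).trace = 0 := by
  obtain ⟨j, hj⟩ := Function.ne_iff.mp hα
  rw [trace_pauliString, Finset.prod_eq_zero (Finset.mem_univ j) (trace_pauliMat hj), mul_zero]

end PauliString

/-- The sum of a finite, multiplicatively closed set of invertible elements is idempotent up to
the cardinality of the set. -/
theorem sum_mul_sum_eq_card_nsmul {R : Type*} [Ring R] {H : Finset R}
    (hmul : ∀ g ∈ H, ∀ h ∈ H, g * h ∈ H) (hunit : ∀ g ∈ H, IsUnit g) :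
    (∑ h ∈ H, h) * ∑ h ∈ H, h = H.card • ∑ h ∈ H, h := by
  rw [Finset.sum_mul, Finset.sum_congr rfl fun g hg => ?_, Finset.sum_const]
  have hinj : Set.InjOn (g * ·) H := fun a _ b _ hab => (hunit g hg).mul_left_cancel hab
  rw [Finset.mul_sum]
  exact Finset.sum_nbij (g * ·) (hmul g hg) hinj
    (Finset.surjOn_of_injOn_of_card_le _ (hmul g hg) hinj le_rfl) fun _ _ => rfl

section Eigenvalues

variable {m : Type*} [Fintype m] [DecidableEq m] {ρ : Matrix m m ℂ} {c : ℝ}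

theorem Matrix.IsHermitian.eigenvalues_eq_zero_or_eq (hρ : ρ.IsHermitian)
    (hsq : ρ * ρ = (c : ℂ) • ρ) (i : m) : hρ.eigenvalues i = 0 ∨ hρ.eigenvalues i = c := by
  have hv := hρ.mulVec_eigenvectorBasis i
  set v := (hρ.eigenvectorBasis i).ofLp with hvdef
  have hv0 : v ≠ 0 := by
    simpa [hvdef] using hρ.eigenvectorBasis.orthonormal.ne_zero i
  have h := congrArg (· *ᵥ v) hsq
  simp only [← Matrix.mulVec_mulVec, Matrix.smul_mulVec, hv, Matrix.mulVec_smul] at h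
  have h' : (hρ.eigenvalues i * hρ.eigenvalues i - c * hρ.eigenvalues i) • v = 0 := by
    rw [sub_smul, mul_smul, mul_smul, h, Complex.coe_smul, sub_self]
  have h2 := (smul_eq_zero.mp h').resolve_right hv0
  rw [← sub_mul, mul_eq_zero, sub_eq_zero] at h2
  exact h2.symm

theorem Matrix.IsHermitian.sum_eigenvalues_eq_one (hρ : ρ.IsHermitian) (htr : ρ.trace = 1) :
    ∑ i, hρ.eigenvalues i = 1 := by
  have h := hρ.trace_eq_sum_eigenvalues
  rw [htr, ← RCLike.ofReal_sum, ← RCLike.ofReal_one, RCLike.ofReal_inj] at h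
  exact h.symm

theorem vnEntropy_eq_neg_logb (hρ : ρ.IsHermitian) (hsq : ρ * ρ = (c : ℂ) • ρ)
    (htr : ρ.trace = 1) : vnEntropy ρ = -Real.logb 2 c := by
  have h (i : m) : hρ.eigenvalues i * Real.logb 2 (hρ.eigenvalues i) =
      hρ.eigenvalues i * Real.logb 2 c := by
    rcases hρ.eigenvalues_eq_zero_or_eq hsq i with h | h <;> simp [h]
  rw [vnEntropy, dif_pos hρ, Finset.sum_congr rfl fun i _ => h i, ← Finset.sum_mul,
    hρ.sum_eigenvalues_eq_one htr, one_mul]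

theorem exists_nat_mul_eq_one (hρ : ρ.IsHermitian) (hsq : ρ * ρ = (c : ℂ) • ρ)
    (htr : ρ.trace = 1) : ∃ k : ℕ, k * c = 1 := by
  classical
  refine ⟨(Finset.univ.filter fun i => hρ.eigenvalues i ≠ 0).card, ?_⟩
  rw [← hρ.sum_eigenvalues_eq_one htr, ← Finset.sum_filter_ne_zero, ← nsmul_eq_mul]
  refine (Finset.sum_eq_card_nsmul fun i hi => ?_).symm
  exact (hρ.eigenvalues_eq_zero_or_eq hsq i).resolve_left (Finset.mem_filter.mp hi).2

end Eigenvalues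

/-- for a finite abelian group `H` of `n`-qubit Pauli strings with phases `±1`
and `-I ∉ H`, one has `|H| = 2^ℓ` with `ℓ ≤ n`, and the base-2 von Neumann entropy of
`ρ = 2⁻ⁿ ∑_{h ∈ H} h` equals `n − log₂|H| = n − ℓ`, a nonnegative integer. -/
theorem stabilizer_state_entropy
    (n : ℕ) (hn : 1 ≤ n)
    (H : Finset (Matrix (Fin n → Fin 2) (Fin n → Fin 2) ℂ))
    (hPauli : ∀ g ∈ H, ∃ φ : ℂ, (φ = 1 ∨ φ = -1) ∧ ∃ α : Fin n → Fin 4, g = pauliString φ α)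
    (hone : (1 : Matrix (Fin n → Fin 2) (Fin n → Fin 2) ℂ) ∈ H)
    (hmul : ∀ g ∈ H, ∀ h ∈ H, g * h ∈ H)
    (hinv : ∀ g ∈ H, g⁻¹ ∈ H)
    (hcomm : ∀ g ∈ H, ∀ h ∈ H, g * h = h * g)
    (hnegI : (-1 : Matrix (Fin n → Fin 2) (Fin n → Fin 2) ℂ) ∉ H) :
    letI ρ : Matrix (Fin n → Fin 2) (Fin n → Fin 2) ℂ := ((2 : ℂ) ^ n)⁻¹ • ∑ h ∈ H, h
    ∃ ℓ : ℕ, ℓ ≤ n ∧ H.card = 2 ^ ℓ ∧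
      vnEntropy ρ = (n : ℝ) - Real.logb 2 (H.card : ℝ) ∧
      vnEntropy ρ = (n : ℝ) - (ℓ : ℝ) := by
  set ρ := ((2 : ℂ) ^ n)⁻¹ • ∑ h ∈ H, h
  have hstar {φ : ℂ} (hφ : φ = 1 ∨ φ = -1) : star φ = φ := by rcases hφ with rfl | rfl <;> simp
  have hsqone : ∀ g ∈ H, g * g = 1 := fun g hg => by
    obtain ⟨φ, hφ, α, rfl⟩ := hPauli g hg
    rw [pauliString_mul_self]
    rcases hφ with rfl | rfl <;> simp
  have htrace : ∀ g ∈ H, g ≠ 1 → g.trace = 0 := fun g hg hg1 => by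
    obtain ⟨φ, hφ, α, rfl⟩ := hPauli g hg
    refine trace_pauliString_eq_zero fun hα => ?_
    rw [hα, pauliString_zero] at hg hg1
    rcases hφ with rfl | rfl
    · simp at hg1
    · simp [hnegI] at hg
  have hcard : (0 : ℝ) < H.card := by exact_mod_cast Finset.card_pos.mpr ⟨1, hone⟩
  have hρ : ρ.IsHermitian := by
    have hsum : (∑ h ∈ H, h).IsHermitian := by
      rw [Matrix.IsHermitian, Matrix.conjTranspose_sum]
      refine Finset.sum_congr rfl fun g hg => ?_
      obtain ⟨φ, hφ, α, rfl⟩ := hPauli g hg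
      exact pauliString_isHermitian (hstar hφ) α
    rw [Matrix.IsHermitian, Matrix.conjTranspose_smul, hsum.eq]
    simp [ρ]
  have hsq : ρ * ρ = ((H.card / 2 ^ n : ℝ) : ℂ) • ρ := by
    have h := sum_mul_sum_eq_card_nsmul hmul fun g hg => .of_mul_eq_one g (hsqone g hg)
    simp only [ρ, Matrix.smul_mul, Matrix.mul_smul, h, ← Nat.cast_smul_eq_nsmul ℂ, smul_smul]
    congr 1
    push_cast
    ring
  have htr : ρ.trace = 1 := by
    simp only [ρ, Matrix.trace_smul, Matrix.trace_sum]
    rw [Finset.sum_eq_single_of_mem 1 hone htrace]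
    simp [Matrix.trace_one]
  have hent : vnEntropy ρ = n - Real.logb 2 H.card := by
    rw [vnEntropy_eq_neg_logb hρ hsq htr, Real.logb_div hcard.ne' (by positivity),
      Real.logb_pow, Real.logb_self_eq_one one_lt_two]
    ring
  obtain ⟨k, hk⟩ := exists_nat_mul_eq_one hρ hsq htr
  have hdvd : H.card ∣ 2 ^ n := by
    refine ⟨k, ?_⟩
    field_simp at hk
    exact_mod_cast hk.symm.trans (mul_comm _ _)
  obtain ⟨ℓ, hℓ, hH⟩ := (Nat.dvd_prime_pow Nat.prime_two).mp hdvd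
  refine ⟨ℓ, hℓ, hH, hent, ?_⟩
  rw [hent, hH, Nat.cast_pow, Nat.cast_ofNat, Real.logb_pow, Real.logb_self_eq_one one_lt_two,
    mul_one]
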